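/- Let A be a complex unital Banach algebra and x a hyperbolic element (σ(x) ∩ iℝ = ∅) with positive and negative spectral projectors p⁺(x), p⁻(x). For each t ∈ [0,1], the element H(t,x) = ((1-t)x + t)p⁺(x) + ((1-t)x - t)p⁻(x) is hyperbolic, H(0,x) = x, and H(1,x) = 2p⁺(x) - 1. -/

import Mathlib

open Complex

/-- The Riesz projector defined by the contour integral `(1/2πi) ∮ (z - x)⁻¹ dz` over the
circle of center `c` and radius `r`. -/
noncomputable def rieszProjector {A : Type*} [NormedRing A] [NormedAlgebra ℂ A]
    (x : A) (c : ℂ) (r : ℝ) : A :=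
  (2 * (Real.pi : ℂ) * Complex.I)⁻¹ • ∮ z in C(c, r), resolvent x z

open Classical in
/-- The positive spectral projector `p⁺(x)`: the Riesz projector of `x` over a simple
closed curve enclosing exactly the part of the spectrum in the open right half-plane. -/
noncomputable def posProj {A : Type*} [NormedRing A] [NormedAlgebra ℂ A] (x : A) : A :=
  if h : ∃ c r : ℝ, 0 < r ∧
      spectrum ℂ x ∩ {z : ℂ | 0 < z.re} ⊆ Metric.ball (c : ℂ) r ∧
      Disjoint (spectrum ℂ x ∩ {z : ℂ | z.re ≤ 0}) (Metric.closedBall (c : ℂ) r)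
  then rieszProjector x (h.choose : ℂ) h.choose_spec.choose
  else 0

open Classical in
/-- The negative spectral projector `p⁻(x)`: the Riesz projector of `x` over a simple
closed curve enclosing exactly the part of the spectrum in the open left half-plane. -/
noncomputable def negProj {A : Type*} [NormedRing A] [NormedAlgebra ℂ A] (x : A) : A :=
  if h : ∃ c r : ℝ, 0 < r ∧
      spectrum ℂ x ∩ {z : ℂ | z.re < 0} ⊆ Metric.ball (c : ℂ) r ∧
      Disjoint (spectrum ℂ x ∩ {z : ℂ | 0 ≤ z.re}) (Metric.closedBall (c : ℂ) r)
  then rieszProjector x (h.choose : ℂ) h.choose_spec.choose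
  else 0

/-- The homotopy `H(t,x) = ((1-t)x + t)p⁺(x) + ((1-t)x - t)p⁻(x)`. -/
noncomputable def hyperbolicHomotopy {A : Type*} [NormedRing A] [NormedAlgebra ℂ A]
    (x : A) (t : ℝ) : A :=
  ((1 - (t : ℂ)) • x + (t : ℂ) • 1) * posProj x +
    ((1 - (t : ℂ)) • x - (t : ℂ) • 1) * negProj x

open Filter Topology Metric

theorem differentiableAt_circleIntegral_sub_inv_smul {E : Type*} [NormedAddCommGroup E]
    [NormedSpace ℂ E] {f : ℂ → E} {c w : ℂ} {r : ℝ} (hr : 0 ≤ r)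
    (hf : ContinuousOn f (sphere c r)) (hw : w ∉ sphere c r) :
    DifferentiableAt ℂ (fun w => ∮ z in C(c, r), (z - w)⁻¹ • f z) w := by
  obtain ⟨ε, hε, hball⟩ : ∃ ε > 0, ∀ v ∈ ball w ε, ∀ z ∈ sphere c r, ε ≤ ‖z - v‖ := by
    obtain ⟨δ, hδ, hsub⟩ :=
      Metric.isOpen_iff.mp (isClosed_sphere (x := c) (ε := r)).isOpen_compl w hw
    refine ⟨δ / 2, half_pos hδ, fun v hv z hz => ?_⟩
    by_contra! hlt
    refine hsub (a := z) ?_ hz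
    have h := dist_triangle z v w
    rw [mem_ball] at hv ⊢
    rw [dist_eq_norm z v] at h
    linarith
  obtain ⟨M, hM⟩ := (isCompact_sphere c r).exists_bound_of_continuousOn hf
  have hcirc (θ : ℝ) : circleMap c r θ ∈ sphere c r := circleMap_mem_sphere c hr θ
  have hne {v : ℂ} (hv : v ∈ ball w ε) (θ : ℝ) : circleMap c r θ - v ≠ 0 :=
    norm_pos_iff.mp (hε.trans_le (hball v hv _ (hcirc θ)))
  have hfc : Continuous fun θ => f (circleMap c r θ) :=
    hf.comp_continuous (continuous_circleMap c r) hcirc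
  have hd : Continuous (deriv (circleMap c r)) := by
    simp only [funext (deriv_circleMap c r)]
    fun_prop
  have hF {v : ℂ} (hv : v ∈ ball w ε) : Continuous fun θ =>
      deriv (circleMap c r) θ • (circleMap c r θ - v)⁻¹ • f (circleMap c r θ) :=
    hd.smul ((((continuous_circleMap c r).sub continuous_const).inv₀ (hne hv)).smul hfc)
  have hF' : Continuous fun θ =>
      deriv (circleMap c r) θ • ((circleMap c r θ - w) ^ 2)⁻¹ • f (circleMap c r θ) :=
    hd.smul (((((continuous_circleMap c r).sub continuous_const).pow 2).inv₀
      fun θ => pow_ne_zero 2 (hne (mem_ball_self hε) θ)).smul hfc)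
  refine (intervalIntegral.hasDerivAt_integral_of_dominated_loc_of_deriv_le
    (F := fun v θ => deriv (circleMap c r) θ • (circleMap c r θ - v)⁻¹ • f (circleMap c r θ))
    (F' := fun v θ =>
      deriv (circleMap c r) θ • ((circleMap c r θ - v) ^ 2)⁻¹ • f (circleMap c r θ))
    (bound := fun _ => r * ((ε ^ 2)⁻¹ * M)) (ball_mem_nhds w hε) ?_
    ((hF (mem_ball_self hε)).intervalIntegrable _ _) hF'.aestronglyMeasurable ?_
    intervalIntegrable_const ?_).2.differentiableAt
  · filter_upwards [ball_mem_nhds w hε] with v hv using (hF hv).aestronglyMeasurable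
  · refine .of_forall fun θ _ v hv => ?_
    have h := hball v hv _ (hcirc θ)
    rw [norm_smul, norm_smul, norm_inv, norm_pow, deriv_circleMap]
    have : ‖circleMap 0 r θ * I‖ = r := by simp [abs_of_nonneg hr]
    rw [this]
    gcongr
    exact hM _ (hcirc θ)
  · refine .of_forall fun θ _ v hv => ?_
    have h := (((hasDerivAt_id v).const_sub (circleMap c r θ)).inv (hne hv θ)).smul_const
      (f (circleMap c r θ))
    simpa [neg_div, Pi.smul_def] using h.const_smul (deriv (circleMap c r) θ)

theorem ContinuousLinearMap.map_circleIntegral {E F : Type*} [NormedAddCommGroup E]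
    [NormedSpace ℂ E] [CompleteSpace E] [NormedAddCommGroup F] [NormedSpace ℂ F] [CompleteSpace F]
    (L : E →L[ℂ] F) {f : ℂ → E} {c : ℂ} {r : ℝ} (hf : CircleIntegrable f c r) :
    L (∮ z in C(c, r), f z) = ∮ z in C(c, r), L (f z) := by
  simp only [circleIntegral]
  rw [← L.intervalIntegral_comp_comm hf.out]
  simp

section BanachAlgebra

variable {A : Type*} [NormedRing A] [NormedAlgebra ℂ A]

/-- The Cauchy transform `(1/2πi) ∮ (z - w)⁻¹ (z - x)⁻¹ dz` of the resolvent of `x`. -/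
noncomputable def resolventCauchy (x : A) (c : ℂ) (r : ℝ) (w : ℂ) : A :=
  (2 * (Real.pi : ℂ) * I)⁻¹ • ∮ z in C(c, r), (z - w)⁻¹ • resolvent x z

theorem sub_mul_resolvent {x : A} {z : ℂ} (hz : z ∉ spectrum ℂ x) :
    (algebraMap ℂ A z - x) * resolvent x z = 1 :=
  Ring.mul_inverse_cancel _ (spectrum.notMem_iff.mp hz)

theorem resolvent_mul_sub {x : A} {z : ℂ} (hz : z ∉ spectrum ℂ x) :
    resolvent x z * (algebraMap ℂ A z - x) = 1 :=
  Ring.inverse_mul_cancel _ (spectrum.notMem_iff.mp hz)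

theorem Commute.resolvent_right {x y : A} (h : Commute y x) {z : ℂ} (hz : z ∉ spectrum ℂ x) :
    Commute y (resolvent x z) := by
  have h1 := sub_mul_resolvent hz
  have h2 := resolvent_mul_sub hz
  have h3 : Commute y (algebraMap ℂ A z - x) := (Algebra.commute_algebraMap_right z y).sub_right h
  calc y * resolvent x z = resolvent x z * (algebraMap ℂ A z - x) * y * resolvent x z := by
        rw [h2, one_mul]
    _ = resolvent x z * y * ((algebraMap ℂ A z - x) * resolvent x z) := by
        rw [mul_assoc (resolvent x z), ← h3.eq]; noncomm_ring
    _ = resolvent x z * y := by rw [h1, mul_one]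

variable [CompleteSpace A]

theorem differentiableAt_resolvent {x : A} {z : ℂ} (hz : z ∉ spectrum ℂ x) :
    DifferentiableAt ℂ (resolvent x) z :=
  (spectrum.hasDerivAt_resolvent_const_left (spectrum.notMem_iff.mp hz)).differentiableAt

theorem Commute.circleIntegral_right {y : A} {f : ℂ → A} {c : ℂ} {r : ℝ} (hr : 0 ≤ r)
    (hf : CircleIntegrable f c r) (h : ∀ z ∈ sphere c r, Commute y (f z)) :
    Commute y (∮ z in C(c, r), f z) := by
  have h1 := (ContinuousLinearMap.mul ℂ A y).map_circleIntegral hf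
  have h2 := ((ContinuousLinearMap.mul ℂ A).flip y).map_circleIntegral hf
  simp only [ContinuousLinearMap.mul_apply', ContinuousLinearMap.flip_apply] at h1 h2
  rw [Commute, SemiconjBy, h1, h2]
  exact circleIntegral.integral_congr hr fun z hz => h z hz

section Circle

variable {x : A} {c : ℂ} {r : ℝ}

theorem continuousOn_resolvent_sphere (hs : Disjoint (spectrum ℂ x) (sphere c r)) :
    ContinuousOn (resolvent x) (sphere c r) := fun _ hz =>
  (differentiableAt_resolvent (hs.notMem_of_mem_right hz)).continuousAt.continuousWithinAt

theorem continuousOn_sub_inv_smul_resolvent (hs : Disjoint (spectrum ℂ x) (sphere c r)) {w : ℂ}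
    (hw : w ∉ sphere c r) : ContinuousOn (fun z => (z - w)⁻¹ • resolvent x z) (sphere c r) := by
  refine ContinuousOn.smul (ContinuousOn.inv₀ (by fun_prop) fun z hz => ?_)
    (continuousOn_resolvent_sphere hs)
  rw [sub_ne_zero]
  rintro rfl
  exact hw hz

theorem Commute.rieszProjector_right (hr : 0 ≤ r) (hs : Disjoint (spectrum ℂ x) (sphere c r))
    {y : A} (h : Commute y x) : Commute y (rieszProjector x c r) :=
  (Commute.circleIntegral_right hr ((continuousOn_resolvent_sphere hs).circleIntegrable hr)
    fun _ hz => h.resolvent_right (hs.notMem_of_mem_right hz)).smul_right _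

theorem Commute.resolventCauchy_right (hr : 0 ≤ r) (hs : Disjoint (spectrum ℂ x) (sphere c r))
    {w : ℂ} (hw : w ∉ sphere c r) {y : A} (h : Commute y x) :
    Commute y (resolventCauchy x c r w) :=
  (Commute.circleIntegral_right hr
    ((continuousOn_sub_inv_smul_resolvent hs hw).circleIntegrable hr)
    fun _ hz => (h.resolvent_right (hs.notMem_of_mem_right hz)).smul_right _).smul_right _

theorem differentiableAt_resolventCauchy (hr : 0 ≤ r)
    (hs : Disjoint (spectrum ℂ x) (sphere c r)) {w : ℂ} (hw : w ∉ sphere c r) :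
    DifferentiableAt ℂ (resolventCauchy x c r) w :=
  (differentiableAt_circleIntegral_sub_inv_smul hr (continuousOn_resolvent_sphere hs)
    hw).fun_const_smul _

theorem sub_mul_resolventCauchy (hr : 0 ≤ r) (hs : Disjoint (spectrum ℂ x) (sphere c r)) {w : ℂ}
    (hw : w ∉ sphere c r) : (algebraMap ℂ A w - x) * resolventCauchy x c r w =
      ((2 * (Real.pi : ℂ) * I)⁻¹ * ∮ z in C(c, r), (z - w)⁻¹) • (1 : A) - rieszProjector x c r := by
  have hint := (continuousOn_sub_inv_smul_resolvent hs hw).circleIntegrable hr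
  have hmap := (ContinuousLinearMap.mul ℂ A (algebraMap ℂ A w - x)).map_circleIntegral hint
  simp only [ContinuousLinearMap.mul_apply'] at hmap
  have hinv : CircleIntegrable (fun z => (z - w)⁻¹ • (1 : A)) c r := by
    refine ContinuousOn.circleIntegrable hr (ContinuousOn.smul (ContinuousOn.inv₀ (by fun_prop)
      fun z hz => ?_) continuousOn_const)
    rw [sub_ne_zero]
    rintro rfl
    exact hw hz
  rw [resolventCauchy, mul_smul_comm, hmap, rieszProjector, mul_smul, ← smul_sub,
    ← circleIntegral.integral_smul_const, ← circleIntegral.integral_sub hinv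
      ((continuousOn_resolvent_sphere hs).circleIntegrable hr)]
  congr 1
  refine circleIntegral.integral_congr hr fun z hz => ?_
  have hzw : z - w ≠ 0 := by
    rw [sub_ne_zero]
    rintro rfl
    exact hw hz
  have hdecomp : algebraMap ℂ A w - x = (algebraMap ℂ A z - x) - (z - w) • (1 : A) := by
    rw [← Algebra.algebraMap_eq_smul_one, map_sub]
    abel
  simp only [hdecomp, sub_mul, mul_smul_comm, smul_mul_assoc, one_mul, smul_sub,
    inv_smul_smul₀ hzw]
  rw [← sub_mul_resolvent (hs.notMem_of_mem_right hz)]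
  simp only [sub_mul, smul_sub]

theorem sub_mul_resolventCauchy_of_mem_ball (hs : Disjoint (spectrum ℂ x) (sphere c r)) {w : ℂ}
    (hw : w ∈ ball c r) :
    (algebraMap ℂ A w - x) * resolventCauchy x c r w = 1 - rieszProjector x c r := by
  have hr : 0 < r := pos_of_mem_ball hw
  rw [sub_mul_resolventCauchy hr.le hs (fun h => (mem_ball.mp hw).ne h),
    circleIntegral.integral_sub_inv_of_mem_ball hw, inv_mul_cancel₀ two_pi_I_ne_zero, one_smul]

theorem sub_mul_resolventCauchy_of_notMem_closedBall (hr : 0 ≤ r)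
    (hs : Disjoint (spectrum ℂ x) (sphere c r)) {w : ℂ} (hw : w ∉ closedBall c r) :
    (algebraMap ℂ A w - x) * resolventCauchy x c r w = -rieszProjector x c r := by
  have hd : DifferentiableOn ℂ (fun z => (z - w)⁻¹) (closedBall c r) := by
    refine DifferentiableOn.inv (by fun_prop) fun z hz => ?_
    rw [sub_ne_zero]
    rintro rfl
    exact hw hz
  have hzero : ∮ z in C(c, r), (z - w)⁻¹ = 0 :=
    (hd.mono closure_ball_subset_closedBall).diffContOnCl.circleIntegral_eq_zero hr
  rw [sub_mul_resolventCauchy hr hs (fun h => hw (sphere_subset_closedBall h)), hzero, mul_zero,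
    zero_smul, zero_sub]

/-- If `w ↦ (w - x)⁻¹ a` extends holomorphically across the spectrum of `x`, then `a = 0`, by
Liouville's theorem. -/
theorem eq_zero_of_resolvent_mul_extends {a : A} {g : ℂ → A}
    (hg : ∀ w ∈ spectrum ℂ x, DifferentiableAt ℂ g w)
    (hga : ∀ w ∈ spectrum ℂ x, ∀ᶠ v in 𝓝 w, (algebraMap ℂ A v - x) * g v = a) : a = 0 := by
  classical
  set G : ℂ → A := (spectrum ℂ x).piecewise g fun w => resolvent x w * a with hG
  have hout {w : ℂ} (hw : w ∉ spectrum ℂ x) : G w = resolvent x w * a := by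
    simp [hG, Set.piecewise_eq_of_notMem _ _ _ hw]
  have hdiff : Differentiable ℂ G := fun w => by
    by_cases hw : w ∈ spectrum ℂ x
    · refine (hg w hw).congr_of_eventuallyEq ?_
      filter_upwards [hga w hw] with v hv
      by_cases hvs : v ∈ spectrum ℂ x
      · simp [hG, Set.piecewise_eq_of_mem _ _ _ hvs]
      · rw [hout hvs, ← hv, ← mul_assoc, resolvent_mul_sub hvs, one_mul]
    · refine ((differentiableAt_resolvent hw).mul_const a).congr_of_eventuallyEq ?_
      filter_upwards [(spectrum.isClosed x).isOpen_compl.mem_nhds hw] with v hv using hout hv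
  have hev : ∀ᶠ w in cocompact ℂ, w ∉ spectrum ℂ x := (spectrum.isCompact x).compl_mem_cocompact
  have hlim : Tendsto G (cocompact ℂ) (𝓝 0) := by
    have h := (spectrum.resolvent_tendsto_cobounded (𝕜 := ℂ) x).mul_const a
    rw [zero_mul, Metric.cobounded_eq_cocompact] at h
    exact h.congr' (by filter_upwards [hev] with w hw using (hout hw).symm)
  obtain ⟨w, hw⟩ := hev.exists
  have hzero := hdiff.apply_eq_of_tendsto_cocompact w hlim
  rw [hout hw] at hzero
  rw [← one_mul a, ← sub_mul_resolvent hw, mul_assoc, hzero, mul_zero]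

theorem isIdempotentElem_rieszProjector (hr : 0 ≤ r)
    (hs : Disjoint (spectrum ℂ x) (sphere c r)) : IsIdempotentElem (rieszProjector x c r) := by
  classical
  set p := rieszProjector x c r with hp
  set u := resolventCauchy x c r with hu
  set g : ℂ → A := (ball c r).piecewise (fun w => u w * p) fun w => u w * (p - 1) with hg
  have hpart {w : ℂ} (hw : w ∈ spectrum ℂ x) :
      w ∈ ball c r ∨ w ∈ (closedBall c r)ᶜ := by
    have h : dist w c ≠ r := hs.notMem_of_mem_left hw
    simpa using h.lt_or_gt
  have hin {w : ℂ} (hw : w ∈ ball c r) : g =ᶠ[𝓝 w] fun w => u w * p := by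
    filter_upwards [isOpen_ball.mem_nhds hw] with v hv
    simp [hg, Set.piecewise_eq_of_mem _ _ _ hv]
  have hout {w : ℂ} (hw : w ∈ (closedBall c r)ᶜ) : g =ᶠ[𝓝 w] fun w => u w * (p - 1) := by
    filter_upwards [isClosed_closedBall.isOpen_compl.mem_nhds hw] with v hv
    have : v ∉ ball c r := fun h => hv (ball_subset_closedBall h)
    simp [hg, Set.piecewise_eq_of_notMem _ _ _ this]
  have key : p - p * p = 0 := by
    refine eq_zero_of_resolvent_mul_extends (x := x) (g := g) (fun w hw => ?_) fun w hw => ?_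
    · have hd : DifferentiableAt ℂ u w :=
        differentiableAt_resolventCauchy hr hs (hs.notMem_of_mem_left hw)
      rcases hpart hw with h | h
      · exact (hd.mul_const p).congr_of_eventuallyEq (hin h)
      · exact (hd.mul_const (p - 1)).congr_of_eventuallyEq (hout h)
    · rcases hpart hw with h | h
      · filter_upwards [hin h, isOpen_ball.mem_nhds h] with v hv hvb
        rw [hv, ← mul_assoc, sub_mul_resolventCauchy_of_mem_ball hs hvb, sub_mul, one_mul]
      · filter_upwards [hout h, isClosed_closedBall.isOpen_compl.mem_nhds h] with v hv hvb
        rw [hv, ← mul_assoc, sub_mul_resolventCauchy_of_notMem_closedBall hr hs hvb]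
        noncomm_ring
  exact (sub_eq_zero.mp key).symm

/-- The Riesz projectors of two circles which together split the spectrum sum to `1`. -/
theorem rieszProjector_add_rieszProjector_eq_one {c' : ℂ} {r' : ℝ} (hr : 0 ≤ r) (hr' : 0 ≤ r')
    (h : ∀ w ∈ spectrum ℂ x, w ∈ ball c r \ closedBall c' r' ∨ w ∈ ball c' r' \ closedBall c r) :
    rieszProjector x c r + rieszProjector x c' r' = 1 := by
  have hs : Disjoint (spectrum ℂ x) (sphere c r) := Set.disjoint_left.mpr fun w hw hws =>
    (h w hw).elim (fun h => (mem_ball.mp h.1).ne hws) fun h => h.2 (sphere_subset_closedBall hws)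
  have hs' : Disjoint (spectrum ℂ x) (sphere c' r') := Set.disjoint_left.mpr fun w hw hws =>
    (h w hw).elim (fun h => h.2 (sphere_subset_closedBall hws)) fun h => (mem_ball.mp h.1).ne hws
  refine (sub_eq_zero.mp (eq_zero_of_resolvent_mul_extends (x := x)
    (g := fun w => resolventCauchy x c r w + resolventCauchy x c' r' w)
    (fun w hw => ?_) fun w hw => ?_)).symm
  · exact (differentiableAt_resolventCauchy hr hs (hs.notMem_of_mem_left hw)).add
      (differentiableAt_resolventCauchy hr' hs' (hs'.notMem_of_mem_left hw))
  · rcases h w hw with h | h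
    · filter_upwards [(isOpen_ball.sdiff isClosed_closedBall).mem_nhds h] with v hv
      rw [mul_add, sub_mul_resolventCauchy_of_mem_ball hs hv.1,
        sub_mul_resolventCauchy_of_notMem_closedBall hr' hs' hv.2]
      abel
    · filter_upwards [(isOpen_ball.sdiff isClosed_closedBall).mem_nhds h] with v hv
      rw [mul_add, sub_mul_resolventCauchy_of_mem_ball hs' hv.1,
        sub_mul_resolventCauchy_of_notMem_closedBall hr hs hv.2]
      abel

/-- Outside the part of the spectrum enclosed by a circle, `w - x` is invertible on the range of
the Riesz projector, with inverse in the bicommutant of `x`. -/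
theorem exists_sub_mul_eq_rieszProjector (hr : 0 ≤ r)
    (hs : Disjoint (spectrum ℂ x) (sphere c r)) {w : ℂ}
    (hw : w ∈ spectrum ℂ x → w ∉ closedBall c r) :
    ∃ v : A, (∀ y, Commute y x → Commute y v) ∧
      (algebraMap ℂ A w - x) * v = rieszProjector x c r := by
  by_cases hws : w ∈ spectrum ℂ x
  · exact ⟨-resolventCauchy x c r w, fun y hy =>
      (hy.resolventCauchy_right hr hs (hs.notMem_of_mem_left hws)).neg_right, by
      rw [mul_neg, sub_mul_resolventCauchy_of_notMem_closedBall hr hs (hw hws), neg_neg]⟩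
  · exact ⟨resolvent x w * rieszProjector x c r, fun y hy =>
      (hy.resolvent_right hws).mul_right (hy.rieszProjector_right hr hs), by
      rw [← mul_assoc, sub_mul_resolvent hws, one_mul]⟩

end Circle

end BanachAlgebra

theorem IsCompact.exists_subset_ball_of_re_pos {K : Set ℂ} (hK : IsCompact K)
    (hpos : ∀ z ∈ K, 0 < z.re) : ∃ R : ℝ, 0 < R ∧ K ⊆ ball (R : ℂ) R := by
  have hcont : ContinuousOn (fun z : ℂ => ‖z‖ ^ 2 / (2 * z.re)) K :=
    ContinuousOn.div (by fun_prop) (by fun_prop) fun z hz => (mul_pos two_pos (hpos z hz)).ne'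
  obtain ⟨M, hM⟩ := hK.exists_bound_of_continuousOn hcont
  refine ⟨max M 0 + 1, by positivity, fun z hz => ?_⟩
  set R : ℝ := max M 0 + 1
  have hR : 0 < R := by positivity
  have hz0 := hpos z hz
  have h : ‖z‖ ^ 2 / (2 * z.re) < R :=
    (le_abs_self _).trans_lt ((hM z hz).trans_lt ((le_max_left M 0).trans_lt (lt_add_one _)))
  rw [div_lt_iff₀ (by positivity)] at h
  rw [mem_ball, dist_eq_norm]
  refine lt_of_pow_lt_pow_left₀ 2 hR.le ?_
  rw [← normSq_eq_norm_sq, normSq_apply] at h ⊢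
  simp only [sub_re, sub_im, ofReal_re, ofReal_im]
  nlinarith

theorem eq_zero_of_mem_closedBall_of_re_nonpos {R : ℝ} (hR : 0 < R) {z : ℂ}
    (hz : z ∈ closedBall (R : ℂ) R) (hre : z.re ≤ 0) : z = 0 := by
  rw [mem_closedBall, dist_eq_norm] at hz
  have h := pow_le_pow_left₀ (norm_nonneg _) hz 2
  rw [← normSq_eq_norm_sq, normSq_apply] at h
  simp only [sub_re, sub_im, ofReal_re, ofReal_im, sub_zero] at h
  have h1 : R * z.re ≤ 0 := mul_nonpos_of_nonneg_of_nonpos hR.le hre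
  apply Complex.ext
  · simp only [zero_re]; nlinarith [sq_nonneg z.im, sq_nonneg z.re]
  · simp only [zero_im]; nlinarith [sq_nonneg z.im, sq_nonneg z.re]

section Hyperbolic

variable {A : Type*} [NormedRing A] [NormedAlgebra ℂ A]

theorem exists_posProj_eq_rieszProjector [CompleteSpace A] {x : A}
    (hx : spectrum ℂ x ∩ {z : ℂ | z.re = 0} = ∅) :
    ∃ c r : ℝ, 0 < r ∧ spectrum ℂ x ∩ {z : ℂ | 0 < z.re} ⊆ ball (c : ℂ) r ∧
      Disjoint (spectrum ℂ x ∩ {z : ℂ | z.re ≤ 0}) (closedBall (c : ℂ) r) ∧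
      posProj x = rieszProjector x c r := by
  have hre : ∀ z ∈ spectrum ℂ x, z.re ≠ 0 := fun z hz h => (hx ▸ ⟨hz, h⟩ : z ∈ (∅ : Set ℂ))
  have hK : IsCompact (spectrum ℂ x ∩ {z : ℂ | 0 < z.re}) := by
    have : spectrum ℂ x ∩ {z : ℂ | 0 < z.re} = spectrum ℂ x ∩ {z : ℂ | 0 ≤ z.re} := by
      ext z
      exact and_congr_right fun hz =>
        ⟨fun h : 0 < z.re => h.le, fun h : 0 ≤ z.re => h.lt_of_ne (hre z hz).symm⟩
    rw [this]
    exact (spectrum.isCompact x).inter_right (isClosed_le continuous_const continuous_re)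
  have h : ∃ c r : ℝ, 0 < r ∧ spectrum ℂ x ∩ {z : ℂ | 0 < z.re} ⊆ ball (c : ℂ) r ∧
      Disjoint (spectrum ℂ x ∩ {z : ℂ | z.re ≤ 0}) (closedBall (c : ℂ) r) := by
    obtain ⟨R, hR, hsub⟩ := hK.exists_subset_ball_of_re_pos fun z hz => hz.2
    refine ⟨R, R, hR, hsub, Set.disjoint_left.mpr fun z hz hzb => hre z hz.1 ?_⟩
    rw [eq_zero_of_mem_closedBall_of_re_nonpos hR hzb hz.2, zero_re]
  obtain ⟨h1, h2, h3⟩ := h.choose_spec.choose_spec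
  exact ⟨_, _, h1, h2, h3, dif_pos h⟩

theorem exists_negProj_eq_rieszProjector [CompleteSpace A] {x : A}
    (hx : spectrum ℂ x ∩ {z : ℂ | z.re = 0} = ∅) :
    ∃ c r : ℝ, 0 < r ∧ spectrum ℂ x ∩ {z : ℂ | z.re < 0} ⊆ ball (c : ℂ) r ∧
      Disjoint (spectrum ℂ x ∩ {z : ℂ | 0 ≤ z.re}) (closedBall (c : ℂ) r) ∧
      negProj x = rieszProjector x c r := by
  have hneg : spectrum ℂ (-x) ∩ {z : ℂ | z.re = 0} = ∅ := by
    rw [← spectrum.neg_eq]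
    ext z
    simpa using fun hz h => (hx ▸ ⟨hz, by simpa using h⟩ : -z ∈ (∅ : Set ℂ))
  have hball (c r : ℝ) (z : ℂ) : dist (-z) ((-c : ℝ) : ℂ) = dist z c := by
    rw [ofReal_neg, dist_neg_neg]
  have h : ∃ c r : ℝ, 0 < r ∧ spectrum ℂ x ∩ {z : ℂ | z.re < 0} ⊆ ball (c : ℂ) r ∧
      Disjoint (spectrum ℂ x ∩ {z : ℂ | 0 ≤ z.re}) (closedBall (c : ℂ) r) := by
    obtain ⟨c, r, hr, hsub, hdisj, -⟩ := exists_posProj_eq_rieszProjector hneg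
    rw [← spectrum.neg_eq] at hsub hdisj
    refine ⟨-c, r, hr, fun z hz => ?_, Set.disjoint_left.mpr fun z hz hzb => ?_⟩
    · have := hsub (a := -z) ⟨by simpa using hz.1, by simpa using hz.2⟩
      rwa [mem_ball, ← hball c r, neg_neg] at this
    · have hmem : -z ∈ -spectrum ℂ x ∩ {z : ℂ | z.re ≤ 0} :=
        ⟨by simpa using hz.1, by simpa using hz.2⟩
      refine Set.disjoint_left.mp hdisj hmem ?_
      rwa [mem_closedBall, ← hball c r, neg_neg]
  obtain ⟨h1, h2, h3⟩ := h.choose_spec.choose_spec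
  exact ⟨_, _, h1, h2, h3, dif_pos h⟩

end Hyperbolic

/-- Assembling inverses of `a` on `p` and of `b` on the complementary idempotent. -/
theorem isUnit_mul_add_mul_one_sub {R : Type*} [Ring R] {p a b v w : R} (hp : IsIdempotentElem p)
    (hpa : Commute p a) (hpb : Commute p b) (hpv : Commute p v) (hpw : Commute p w)
    (hav : Commute a v) (hbw : Commute b w) (h : a * v = p) (h' : b * w = 1 - p) :
    IsUnit (a * p + b * (1 - p)) := by
  have hq := hp.one_sub
  have hqb : Commute (1 - p) b := (Commute.one_left b).sub_left hpb
  have hqw : Commute (1 - p) w := (Commute.one_left w).sub_left hpw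
  have hpq : p * (1 - p) = 0 := by rw [mul_sub, mul_one, hp.eq, sub_self]
  have hqp : (1 - p) * p = 0 := by rw [sub_mul, one_mul, hp.eq, sub_self]
  have mulp {a b v w p q : R} (hpv : Commute p v) (hqw : Commute q w) (hp : p * p = p)
      (hq : q * q = q) (hpq : p * q = 0) (hqp : q * p = 0) :
      (a * p + b * q) * (v * p + w * q) = a * v * p + b * w * q := by
    have e1 : a * p * (v * p) = a * v * p := by
      rw [mul_assoc, ← mul_assoc p, hpv.eq, mul_assoc v, hp, mul_assoc]
    have e2 : b * q * (w * q) = b * w * q := by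
      rw [mul_assoc, ← mul_assoc q, hqw.eq, mul_assoc w, hq, mul_assoc]
    have e3 : a * p * (w * q) = 0 := by
      rw [← hqw.eq, mul_assoc, ← mul_assoc p, hpq, zero_mul, mul_zero]
    have e4 : b * q * (v * p) = 0 := by
      rw [← hpv.eq, mul_assoc, ← mul_assoc q, hqp, zero_mul, mul_zero]
    rw [add_mul, mul_add, mul_add, e1, e2, e3, e4, add_zero, zero_add]
  refine ⟨⟨_, v * p + w * (1 - p), ?_, ?_⟩, rfl⟩
  · rw [mulp hpv hqw hp hq hpq hqp, h, h', hp.eq, hq.eq, add_sub_cancel]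
  · rw [mulp hpa hqb hp hq hpq hqp, ← hav.eq, ← hbw.eq, h, h', hp.eq, hq.eq, add_sub_cancel]

/-- For a hyperbolic element `x`, each `H(t,x)`, `t ∈ [0,1]`, is hyperbolic, with
`H(0,x) = x` and `H(1,x) = 2p⁺(x) - 1`. -/
theorem hyperbolicHomotopy_spec
    {A : Type*} [NormedRing A] [NormedAlgebra ℂ A] [CompleteSpace A]
    (x : A) (hx : spectrum ℂ x ∩ {z : ℂ | z.re = 0} = ∅) :
    (∀ t ∈ Set.Icc (0 : ℝ) 1,
        spectrum ℂ (hyperbolicHomotopy x t) ∩ {z : ℂ | z.re = 0} = ∅) ∧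
    hyperbolicHomotopy x 0 = x ∧
    hyperbolicHomotopy x 1 = (2 : ℂ) • posProj x - 1 := by
  obtain ⟨c, r, hr, hin, hout, hpos⟩ := exists_posProj_eq_rieszProjector hx
  obtain ⟨c', r', hr', hin', hout', hneg⟩ := exists_negProj_eq_rieszProjector hx
  have hsplit : ∀ w ∈ spectrum ℂ x, w ∈ ball (c : ℂ) r \ closedBall (c' : ℂ) r' ∨
      w ∈ ball (c' : ℂ) r' \ closedBall (c : ℂ) r := fun w hw => by
    have hre : w.re ≠ 0 := fun h => (hx ▸ ⟨hw, h⟩ : w ∈ (∅ : Set ℂ))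
    rcases hre.lt_or_gt with h | h
    · exact .inr ⟨hin' ⟨hw, h⟩, Set.disjoint_left.mp hout ⟨hw, le_of_lt h⟩⟩
    · exact .inl ⟨hin ⟨hw, h⟩, Set.disjoint_left.mp hout' ⟨hw, le_of_lt h⟩⟩
  have hs : Disjoint (spectrum ℂ x) (sphere (c : ℂ) r) := Set.disjoint_left.mpr fun w hw hws =>
    (hsplit w hw).elim (fun h => (mem_ball.mp h.1).ne hws)
      fun h => h.2 (sphere_subset_closedBall hws)
  have hs' : Disjoint (spectrum ℂ x) (sphere (c' : ℂ) r') := Set.disjoint_left.mpr fun w hw hws =>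
    (hsplit w hw).elim (fun h => h.2 (sphere_subset_closedBall hws))
      fun h => (mem_ball.mp h.1).ne hws
  have hsum : posProj x + negProj x = 1 := by
    rw [hpos, hneg, rieszProjector_add_rieszProjector_eq_one hr.le hr'.le hsplit]
  have hnegEq : negProj x = 1 - posProj x := eq_sub_of_add_eq' hsum
  have hidem : IsIdempotentElem (posProj x) := hpos ▸ isIdempotentElem_rieszProjector hr.le hs
  have hpx : Commute (posProj x) x := hpos ▸ ((Commute.refl x).rieszProjector_right hr.le hs).symm
  refine ⟨fun t ht => ?_, ?_, ?_⟩
  · refine Set.eq_empty_of_forall_notMem fun z ⟨hz, hz0⟩ => hz ?_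
    rw [Set.mem_ofPred_eq] at hz0
    change IsUnit (algebraMap ℂ A z - hyperbolicHomotopy x t)
    have hform : algebraMap ℂ A z - hyperbolicHomotopy x t =
        (algebraMap ℂ A (z - t) - (1 - (t : ℂ)) • x) * posProj x +
          (algebraMap ℂ A (z + t) - (1 - (t : ℂ)) • x) * (1 - posProj x) := by
      rw [hyperbolicHomotopy, hnegEq, map_sub, map_add, Algebra.algebraMap_eq_smul_one (t : ℂ)]
      noncomm_ring
    have hscale {s : ℂ} {p : A} {w : ℂ} (h : ∃ v : A, (∀ y, Commute y x → Commute y v) ∧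
        (algebraMap ℂ A (w / s) - x) * v = p) (hs0 : s ≠ 0) :
        ∃ v : A, (∀ y, Commute y x → Commute y v) ∧ (algebraMap ℂ A w - s • x) * v = p := by
      obtain ⟨v, hv, hvp⟩ := h
      refine ⟨s⁻¹ • v, fun y hy => (hv y hy).smul_right _, ?_⟩
      have : algebraMap ℂ A w - s • x = s • (algebraMap ℂ A (w / s) - x) := by
        rw [smul_sub, Algebra.algebraMap_eq_smul_one, Algebra.algebraMap_eq_smul_one, smul_smul,
          mul_div_cancel₀ _ hs0]
      rw [this, smul_mul_smul_comm, mul_inv_cancel₀ hs0, one_smul, hvp]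
    have hconst {w : ℂ} (hw : w ≠ 0) {p : A} (hp : ∀ y, Commute y x → Commute y p) :
        ∃ v : A, (∀ y, Commute y x → Commute y v) ∧ (algebraMap ℂ A w - (0 : ℂ) • x) * v = p :=
      ⟨w⁻¹ • p, fun y hy => (hp y hy).smul_right _, by
        rw [zero_smul, sub_zero, Algebra.algebraMap_eq_smul_one, smul_mul_smul_comm,
          mul_inv_cancel₀ hw, one_smul, one_mul]⟩
    have hplus : ∃ v : A, (∀ y, Commute y x → Commute y v) ∧
        (algebraMap ℂ A (z - t) - (1 - (t : ℂ)) • x) * v = posProj x := by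
      rcases ht.2.eq_or_lt with rfl | ht1
      · rw [ofReal_one, sub_self]
        refine hconst (fun h => ?_) fun y hy => hpos ▸ hy.rieszProjector_right hr.le hs
        simpa [hz0] using congrArg re h
      · have h1 : (1 - (t : ℂ)) = ((1 - t : ℝ) : ℂ) := by push_cast; rfl
        rw [h1, hpos]
        refine hscale (exists_sub_mul_eq_rieszProjector hr.le hs fun hw =>
          Set.disjoint_left.mp hout ⟨hw, ?_⟩) (ofReal_ne_zero.mpr (sub_pos.mpr ht1).ne')
        rw [Set.mem_ofPred_eq, div_ofReal_re, sub_re, hz0, ofReal_re, zero_sub]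
        exact div_nonpos_of_nonpos_of_nonneg (neg_nonpos.mpr ht.1) (sub_pos.mpr ht1).le
    have hminus : ∃ v : A, (∀ y, Commute y x → Commute y v) ∧
        (algebraMap ℂ A (z + t) - (1 - (t : ℂ)) • x) * v = 1 - posProj x := by
      rw [← hnegEq]
      rcases ht.2.eq_or_lt with rfl | ht1
      · rw [ofReal_one, sub_self]
        refine hconst (fun h => ?_) fun y hy => hneg ▸ hy.rieszProjector_right hr'.le hs'
        simpa [hz0] using congrArg re h
      · have h1 : (1 - (t : ℂ)) = ((1 - t : ℝ) : ℂ) := by push_cast; rfl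
        rw [h1, hneg]
        refine hscale (exists_sub_mul_eq_rieszProjector hr'.le hs' fun hw =>
          Set.disjoint_left.mp hout' ⟨hw, ?_⟩) (ofReal_ne_zero.mpr (sub_pos.mpr ht1).ne')
        rw [Set.mem_ofPred_eq, div_ofReal_re, add_re, hz0, ofReal_re, zero_add]
        exact div_nonneg ht.1 (sub_pos.mpr ht1).le
    obtain ⟨v, hv, hvp⟩ := hplus
    obtain ⟨w, hw, hwp⟩ := hminus
    have hcomm {y : A} (hy : Commute y x) (s k : ℂ) : Commute y (algebraMap ℂ A k - s • x) :=
      (Algebra.commute_algebraMap_right k y).sub_right (hy.smul_right s)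
    rw [hform]
    exact isUnit_mul_add_mul_one_sub hidem (hcomm hpx _ _) (hcomm hpx _ _) (hv _ hpx) (hw _ hpx)
      (hv _ (hcomm (.refl x) _ _).symm) (hw _ (hcomm (.refl x) _ _).symm) hvp hwp
  · simp [hyperbolicHomotopy, ← mul_add, hsum]
  · simp only [hyperbolicHomotopy, hnegEq, ofReal_one, sub_self, zero_smul, one_smul, zero_add,
      zero_sub, one_mul, neg_mul, two_smul]
    abel
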